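/- Every alternating n×n matrix X over a field F is U-congruent to a unique sub-permutation matrix; that is, there is exactly one sub-permutation matrix Y such that Y = h'Xh for some h ∈ U. -/

import Mathlib

open Matrix

variable {F : Type*} [Field F] {n : ℕ}

/-- Membership in `U`: upper triangular matrices with all diagonal entries 1. -/
def InU (h : Matrix (Fin n) (Fin n) F) : Prop :=
  (∀ i, h i i = 1) ∧ ∀ i j : Fin n, j < i → h i j = 0

/-- A sub-permutation matrix: at most one nonzero entry in every row and column. -/
def SubPerm (Y : Matrix (Fin n) (Fin n) F) : Prop :=
  (∀ i j k : Fin n, Y i j ≠ 0 → Y i k ≠ 0 → j = k) ∧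
  (∀ i j k : Fin n, Y i k ≠ 0 → Y j k ≠ 0 → i = j)

/-- An alternating matrix: `Xᵀ = -X` and all diagonal entries are 0. -/
def IsAlternating (X : Matrix (Fin n) (Fin n) F) : Prop :=
  Xᵀ = -X ∧ ∀ i, X i i = 0

theorem InU.one : InU (1 : Matrix (Fin n) (Fin n) F) :=
  ⟨fun _ => one_apply_eq _, fun _ _ h => one_apply_ne h.ne'⟩

theorem InU.blockTriangular {h : Matrix (Fin n) (Fin n) F} (hh : InU h) :
    h.BlockTriangular id :=
  fun i j hij => hh.2 i j hij

theorem InU.det {h : Matrix (Fin n) (Fin n) F} (hh : InU h) : h.det = 1 := by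
  rw [det_of_isUpperTriangular hh.blockTriangular]
  exact Finset.prod_eq_one fun i _ => hh.1 i

/-- The diagonal of a product of upper triangular matrices is the product of the diagonals. -/
theorem mul_apply_diag_of_blockTriangular {g h : Matrix (Fin n) (Fin n) F}
    (hg : g.BlockTriangular id) (hh : h.BlockTriangular id) (i : Fin n) :
    (g * h) i i = g i i * h i i := by
  rw [mul_apply]
  refine Finset.sum_eq_single i (fun k _ hk => ?_) (by simp)
  rcases lt_or_gt_of_ne hk with hlt | hlt
  · rw [hg (show id k < id i from hlt), zero_mul]
  · rw [hh (show id i < id k from hlt), mul_zero]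

theorem InU.mul {g h : Matrix (Fin n) (Fin n) F} (hg : InU g) (hh : InU h) : InU (g * h) :=
  ⟨fun i => by
    rw [mul_apply_diag_of_blockTriangular hg.blockTriangular hh.blockTriangular, hg.1, hh.1,
      one_mul],
   fun _ _ hij => hg.blockTriangular.mul hh.blockTriangular hij⟩

theorem InU.isUnit_det {h : Matrix (Fin n) (Fin n) F} (hh : InU h) : IsUnit h.det := by
  rw [hh.det]
  exact isUnit_one

theorem InU.inv {h : Matrix (Fin n) (Fin n) F} (hh : InU h) : InU h⁻¹ := by
  let := invertibleOfIsUnitDet h hh.isUnit_det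
  have hb : h⁻¹.BlockTriangular id := blockTriangular_inv_of_blockTriangular hh.blockTriangular
  refine ⟨fun i => ?_, fun _ _ hij => hb hij⟩
  have := mul_apply_diag_of_blockTriangular hh.blockTriangular hb i
  rwa [mul_nonsing_inv h hh.isUnit_det, one_apply_eq, hh.1, one_mul, eq_comm] at this

/-- Two sub-permutation matrices in the same double coset of the lower and the upper
unitriangular group are equal. -/
theorem SubPerm.eq_of_transpose_mul_eq_mul {Y Z g h : Matrix (Fin n) (Fin n) F}
    (hY : SubPerm Y) (hZ : SubPerm Z) (hg : InU g) (hh : InU h) (e : gᵀ * Z = Y * h) :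
    Y = Z := by
  have left (i k j) (hij : Z k j ≠ 0) : (gᵀ * Z) i j = g k i * Z k j := by
    rw [mul_apply]
    refine Finset.sum_eq_single k (fun l _ hl => ?_) (by simp)
    rw [show Z l j = 0 from by_contra fun h0 => hl (hZ.2 _ _ _ h0 hij), mul_zero]
  have right (i k j) (hij : Y i k ≠ 0) : (Y * h) i j = Y i k * h k j := by
    rw [mul_apply]
    refine Finset.sum_eq_single k (fun l _ hl => ?_) (by simp)
    rw [show Y i l = 0 from by_contra fun h0 => hl (hY.1 _ _ _ h0 hij), zero_mul]
  have down (i k) (hik : Y i k ≠ 0) : ∃ i' ≤ i, Z i' k ≠ 0 := by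
    have h1 : (gᵀ * Z) i k ≠ 0 := by rwa [e, right i k k hik, hh.1, mul_one]
    rw [mul_apply] at h1
    obtain ⟨l, -, hl⟩ := Finset.exists_ne_zero_of_sum_ne_zero h1
    refine ⟨l, ?_, right_ne_zero_of_mul hl⟩
    by_contra! hlt
    exact left_ne_zero_of_mul hl (hg.2 _ _ hlt)
  have eq_of_left (i j) (hij : Z i j ≠ 0) : Y i j = Z i j := by
    induction i using WellFoundedLT.induction generalizing j with
    | ind i ih =>
    have h1 : (Y * h) i j = Z i j := by rw [← e, left i i j hij, hg.1, one_mul]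
    have h2 : (Y * h) i j ≠ 0 := by rwa [h1]
    rw [mul_apply] at h2
    obtain ⟨k, -, hk⟩ := Finset.exists_ne_zero_of_sum_ne_zero h2
    have hik : Y i k ≠ 0 := left_ne_zero_of_mul hk
    obtain ⟨i', hle, hi'⟩ := down i k hik
    obtain rfl : i' = i := by
      rcases hle.lt_or_eq with hlt | heq
      · exact hY.2 i' i k (by rwa [ih i' hlt k hi']) hik
      · exact heq
    obtain rfl : k = j := hZ.1 _ _ _ hi' hij
    rw [← h1, right i' k k hik, hh.1, mul_one]
  ext i j
  by_cases hij : Z i j = 0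
  · rw [hij]
    by_contra h0
    obtain ⟨i', -, hi'⟩ := down i j h0
    have h1 := eq_of_left i' j hi'
    obtain rfl := hY.2 i' i j (by rwa [h1]) h0
    exact hi' hij
  · exact eq_of_left i j hij

theorem IsAlternating.apply_swap {X : Matrix (Fin n) (Fin n) F} (hX : IsAlternating X)
    (a b : Fin n) : X a b = -X b a := by
  simpa using congrFun₂ hX.1 b a

/-- For an alternating matrix `X` with `X i j ≠ 0`, the change of basis which fixes the basis
vectors `i` and `j` and projects the other ones to the orthogonal complement of these two. -/
def pivotMatrix (X : Matrix (Fin n) (Fin n) F) (i j : Fin n) : Matrix (Fin n) (Fin n) F :=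
  fun a b => (if a = b then 1 else 0) -
    (if a = j then (if b = i ∨ b = j then 0 else X i b / X i j) else 0) +
    (if a = i then (if b = i ∨ b = j then 0 else X j b / X i j) else 0)

theorem mul_pivotMatrix_apply (X Z : Matrix (Fin n) (Fin n) F) (i j a b : Fin n) :
    (Z * pivotMatrix X i j) a b =
      Z a b - Z a j * (if b = i ∨ b = j then 0 else X i b / X i j) +
        Z a i * (if b = i ∨ b = j then 0 else X j b / X i j) := by
  simp only [mul_apply, pivotMatrix, mul_add, mul_sub, Finset.sum_add_distrib,
    Finset.sum_sub_distrib, mul_ite, mul_one, mul_zero, Finset.sum_ite_eq', Finset.mem_univ,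
    if_true]

theorem pivotMatrix_congr_apply (X : Matrix (Fin n) (Fin n) F) (i j a b : Fin n) :
    ((pivotMatrix X i j)ᵀ * X * pivotMatrix X i j) a b =
      (X * pivotMatrix X i j) a b -
        (if a = i ∨ a = j then 0 else X i a / X i j) * (X * pivotMatrix X i j) j b +
        (if a = i ∨ a = j then 0 else X j a / X i j) * (X * pivotMatrix X i j) i b := by
  rw [Matrix.mul_assoc]
  generalize X * pivotMatrix X i j = Z
  have := mul_pivotMatrix_apply X Zᵀ i j b a
  rw [← transpose_apply (Zᵀ * _), transpose_mul, transpose_transpose] at this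
  rw [this]
  simp only [transpose_apply]
  ring

theorem IsAlternating.mul_pivotMatrix_left {X : Matrix (Fin n) (Fin n) F}
    (hX : IsAlternating X) {i j : Fin n} (hij : X i j ≠ 0) (b : Fin n) :
    (X * pivotMatrix X i j) i b = if b = j then X i j else 0 := by
  rw [mul_pivotMatrix_apply, hX.2]
  by_cases hbj : b = j
  · simp [hbj]
  by_cases hbi : b = i
  · simp [hbi, hX.2, show i ≠ j from hbi ▸ hbj]
  simp [hbi, hbj, mul_div_cancel₀, hij]

theorem IsAlternating.mul_pivotMatrix_right {X : Matrix (Fin n) (Fin n) F}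
    (hX : IsAlternating X) {i j : Fin n} (hij : X i j ≠ 0) (b : Fin n) :
    (X * pivotMatrix X i j) j b = if b = i then X j i else 0 := by
  rw [mul_pivotMatrix_apply, hX.2]
  by_cases hbi : b = i
  · simp [hbi]
  by_cases hbj : b = j
  · simp [hbj, hX.2, show j ≠ i from hbj ▸ hbi]
  rw [hX.apply_swap j i]
  simp only [hbi, hbj, or_self, if_false]
  field_simp
  ring

theorem IsAlternating.pivotMatrix_congr {X : Matrix (Fin n) (Fin n) F}
    (hX : IsAlternating X) {i j : Fin n} (hij : X i j ≠ 0) :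
    IsAlternating ((pivotMatrix X i j)ᵀ * X * pivotMatrix X i j) := by
  refine ⟨?_, fun a => ?_⟩
  · rw [transpose_mul, transpose_mul, transpose_transpose, hX.1]
    simp [Matrix.mul_assoc]
  · rw [pivotMatrix_congr_apply, hX.mul_pivotMatrix_left hij, hX.mul_pivotMatrix_right hij,
      mul_pivotMatrix_apply, hX.2]
    by_cases ha : a = i ∨ a = j
    · simp [ha]
    · rw [hX.apply_swap a j, hX.apply_swap a i]
      simp only [not_or.1 ha, or_self, if_false]
      ring

/-- If the rows of an alternating matrix indexed by `S` are already reduced, and the rest of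
these rows is zero, then the matrix is `U`-congruent to a sub-permutation matrix. -/
theorem IsAlternating.exists_subPerm_congr_of_reduced {X : Matrix (Fin n) (Fin n) F}
    (hX : IsAlternating X) (S : Finset (Fin n))
    (hS : ∀ a ∈ S, ∀ b ∉ S, X a b = 0)
    (hred : ∀ a ∈ S, ∀ b c, X a b ≠ 0 → X a c ≠ 0 → b = c) :
    ∃ h : Matrix (Fin n) (Fin n) F, InU h ∧ SubPerm (hᵀ * X * h) := by
  induction hk : Sᶜ.card using Nat.strong_induction_on generalizing X S with
  | _ k ih =>
  by_cases hne : ∃ i, i ∉ S ∧ ∃ j, X i j ≠ 0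
  · obtain ⟨i, ⟨hiS, hi⟩, hmin⟩ := WellFounded.has_min (wellFounded_lt (α := Fin n))
      {i | i ∉ S ∧ ∃ j, X i j ≠ 0} hne
    obtain ⟨j, hij, hjmin⟩ := WellFounded.has_min (wellFounded_lt (α := Fin n))
      {j | X i j ≠ 0} hi
    replace hij : X i j ≠ 0 := hij
    have hjS : j ∉ S := fun hj => hij <| by rw [hX.apply_swap, hS j hj i hiS, neg_zero]
    have hne' : i ≠ j := fun e => hij (e ▸ hX.2 i)
    have hzero (a) (ha : a ∈ S) (c) (hc : c ∉ S) : X c a = 0 := by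
      rw [hX.apply_swap, hS a ha c hc, neg_zero]
    have hlt_j (b) (hb : b ≠ j) (h0 : X i b ≠ 0) : j < b :=
      lt_of_le_of_ne (not_lt.1 (hjmin b h0)) hb.symm
    have hlt_i (b) (hb : b ≠ i) (h0 : X j b ≠ 0) : i < b := by
      refine lt_of_le_of_ne (not_lt.1 (hmin b ⟨fun hbS => h0 (hzero b hbS j hjS), j, ?_⟩)) hb.symm
      rw [hX.apply_swap]
      exact neg_ne_zero.2 h0
    have hU : InU (pivotMatrix X i j) := by
      constructor
      · intro a
        by_cases hai : a = i
        · simp [pivotMatrix, hai]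
        · by_cases haj : a = j <;> simp [pivotMatrix, hai, haj]
      · intro a b hab
        by_cases hb : b = i ∨ b = j
        · simp [pivotMatrix, hb, hab.ne']
        · have h1 : a = j → X i b = 0 := fun e => by_contra fun h0 =>
            absurd (hlt_j b (not_or.1 hb).2 h0) (e ▸ hab.not_gt)
          have h2 : a = i → X j b = 0 := fun e => by_contra fun h0 =>
            absurd (hlt_i b (not_or.1 hb).1 h0) (e ▸ hab.not_gt)
          simp +contextual [pivotMatrix, hb, hab.ne', h1, h2]
    have hrow_i (b) : ((pivotMatrix X i j)ᵀ * X * pivotMatrix X i j) i b =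
        if b = j then X i j else 0 := by
      rw [pivotMatrix_congr_apply, ← hX.mul_pivotMatrix_left hij]
      simp
    have hrow_j (b) : ((pivotMatrix X i j)ᵀ * X * pivotMatrix X i j) j b =
        if b = i then X j i else 0 := by
      rw [pivotMatrix_congr_apply, ← hX.mul_pivotMatrix_right hij]
      simp
    have hrow (a) (ha : a ∈ S) (b) :
        ((pivotMatrix X i j)ᵀ * X * pivotMatrix X i j) a b = X a b := by
      rw [pivotMatrix_congr_apply, mul_pivotMatrix_apply, hzero a ha i hiS, hzero a ha j hjS,
        hS a ha i hiS, hS a ha j hjS]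
      simp
    obtain ⟨h, hh, hsub⟩ := ih (insert i (insert j S))ᶜ.card
      (by
        rw [← hk]
        refine Finset.card_lt_card (Finset.compl_ssubset_compl.2 ?_)
        exact Finset.ssubset_iff.2 ⟨i, hiS, Finset.insert_subset_insert _
          (Finset.subset_insert _ _)⟩)
      (hX.pivotMatrix_congr hij) (insert i (insert j S))
      (by
        intro a ha b hb
        simp only [Finset.mem_insert, not_or] at ha hb
        rcases ha with rfl | rfl | ha
        · rw [hrow_i, if_neg hb.2.1]
        · rw [hrow_j, if_neg hb.1]
        · rw [hrow a ha, hS a ha b hb.2.2])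
      (by
        intro a ha b c
        simp only [Finset.mem_insert] at ha
        rcases ha with rfl | rfl | ha
        · rw [hrow_i, hrow_i]
          grind
        · rw [hrow_j, hrow_j]
          grind
        · rw [hrow a ha, hrow a ha]
          exact hred a ha b c)
      rfl
    refine ⟨pivotMatrix X i j * h, hU.mul hh, ?_⟩
    simpa only [transpose_mul, Matrix.mul_assoc] using hsub
  · push Not at hne
    have hrow (a b c) (hb : X a b ≠ 0) (hc : X a c ≠ 0) : b = c :=
      hred a (by_contra fun ha => hb (hne a ha b)) b c hb hc
    refine ⟨1, InU.one, ?_⟩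
    rw [transpose_one, Matrix.one_mul, Matrix.mul_one]
    refine ⟨hrow, fun a b c ha hb => hrow c a b ?_ ?_⟩
    · rw [hX.apply_swap]
      exact neg_ne_zero.2 ha
    · rw [hX.apply_swap]
      exact neg_ne_zero.2 hb

/-- Every alternating matrix is `U`-congruent to a unique sub-permutation matrix. -/
theorem alt_unique_subperm_U_congruent (hn : 2 ≤ n)
    (X : Matrix (Fin n) (Fin n) F) (hX : IsAlternating X) :
    ∃! Y : Matrix (Fin n) (Fin n) F, SubPerm Y ∧
      ∃ h : Matrix (Fin n) (Fin n) F, InU h ∧ Y = hᵀ * X * h := by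
  obtain ⟨h, hh, hsub⟩ := hX.exists_subPerm_congr_of_reduced ∅ (by simp) (by simp)
  refine ⟨_, ⟨hsub, h, hh, rfl⟩, ?_⟩
  rintro Z ⟨hZ, g, hg, rfl⟩
  refine (hsub.eq_of_transpose_mul_eq_mul hZ (hg.inv.mul hh) (hh.inv.mul hg) ?_).symm
  have hg' : (g⁻¹)ᵀ * gᵀ = 1 := by
    rw [← transpose_mul, mul_nonsing_inv g hg.isUnit_det, transpose_one]
  calc (g⁻¹ * h)ᵀ * (gᵀ * X * g) = hᵀ * ((g⁻¹)ᵀ * gᵀ) * X * g := by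
        simp only [transpose_mul, Matrix.mul_assoc]
    _ = hᵀ * X * (h * h⁻¹) * g := by
        rw [hg', mul_nonsing_inv h hh.isUnit_det, Matrix.mul_one, Matrix.mul_one]
    _ = hᵀ * X * h * (h⁻¹ * g) := by simp only [Matrix.mul_assoc]
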